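/- Let 𝔇 = (S, s₀, K, 𝔓) be a family of MCs, G ⊆ S, and λ ∈ [0,1]. There exists a memoryless deterministic scheduler σ of the all-in-one MDP M^𝔇 such that the induced MC started at 'none' reaches the lifted goal set {some (s, r') | s ∈ G, r' ∈ R^𝔇} with probability at most λ if and only if there exists a consistent memoryless deterministic scheduler σ* : S → R^𝔇 of the quotient MDP M^𝔇_∼ such that the MC induced by σ*, started at s₀, satisfies Prob(◇G) ≤ λ. -/

import Mathlib

open MeasureTheory
open scoped ENNReal NNReal Classical

/-- A family of Markov chains `𝔇 = (S, s₀, K, 𝔓)`: finite state space `S`,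
initial state `s₀`, finite parameter set `K` with nonempty finite domains `T k ⊆ S`,
and a parametric transition function `𝔓 : S → Distr(K)`. -/
structure MCFamily (S K : Type) [Fintype S] [Fintype K] where
  s0 : S
  T : K → Finset S
  T_nonempty : ∀ k, (T k).Nonempty
  P : S → PMF K

variable {S K : Type} [Fintype S] [Fintype K]

/-- The set `R^𝔇` of realisations of the family. -/
def Realisations (𝔇 : MCFamily S K) : Set (K → S) :=
  {r | ∀ k, r k ∈ 𝔇.T k}

/-- Transition matrix of the Markov chain `D_r` induced by realisation `r`:
at state `s` it is the pushforward of `𝔓(s)` under `r`. -/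
noncomputable def familyTrans (𝔇 : MCFamily S K) (r : K → S) (s : S) : PMF S :=
  (𝔇.P s).map r

/-- The `k`-th binary digit of the fractional part of `u`. -/
noncomputable def bit (k : ℕ) (u : ℝ) : ℕ := ⌊u * 2 ^ (k + 1)⌋.toNat % 2

/-- From one uniform `u ∈ [0,1)`, extract the `i`-th member of an i.i.d. sequence of
uniform random variables, by de-interleaving binary digits. -/
noncomputable def uSlice (i : ℕ) (u : ℝ) : ℝ :=
  ∑' k : ℕ, (bit (Nat.pair i k) u : ℝ) / 2 ^ (k + 1)

/-- Cumulative distribution values of a PMF on a finite type, w.r.t. a fixed enumeration. -/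
noncomputable def cumul {σ : Type} [Fintype σ] (P : PMF σ) (j : ℕ) : ℝ :=
  ∑ i ∈ Finset.univ.filter (fun i : Fin (Fintype.card σ) => (i : ℕ) < j),
    (P ((Fintype.equivFin σ).symm i)).toReal

/-- Inverse-CDF sampling: if `u` is uniform on `[0,1)` then `sample P u` has law `P`. -/
noncomputable def sample {σ : Type} [Fintype σ] [Nonempty σ] (P : PMF σ) (u : ℝ) : σ :=
  (Fintype.equivFin σ).symm <|
    if h : (Finset.univ.filter fun j : Fin (Fintype.card σ) =>
        u < cumul P ((j : ℕ) + 1)).Nonempty then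
      (Finset.univ.filter fun j : Fin (Fintype.card σ) =>
        u < cumul P ((j : ℕ) + 1)).min' h
    else ⟨0, Fintype.card_pos⟩

/-- Simulation of the Markov chain with transition function `P` started in `init`,
driven by the i.i.d. uniform sequence extracted from `u`. -/
noncomputable def simTraj {σ : Type} [Fintype σ] [Nonempty σ]
    (P : σ → PMF σ) (init : σ) (u : ℝ) : ℕ → σ
  | 0 => init
  | n + 1 => sample (P (simTraj P init u n)) (uSlice n u)

/-- The law of the trajectories (`ℕ → σ` with the product of discrete σ-algebras) of the
Markov chain with transition function `P` and initial distribution `δ_init`; it is obtained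
as the pushforward of the uniform distribution on `[0,1)` under the simulation map, which
coincides with the measure given by the Ionescu–Tulcea construction. -/
noncomputable def trajMeasure {σ : Type} [Fintype σ] [Nonempty σ]
    (P : σ → PMF σ) (init : σ) :
    @Measure (ℕ → σ) (@MeasurableSpace.pi ℕ (fun _ => σ) (fun _ => ⊤)) :=
  @Measure.map ℝ (ℕ → σ) _ (@MeasurableSpace.pi ℕ (fun _ => σ) (fun _ => ⊤))
    (simTraj P init) ((volume : Measure ℝ).restrict (Set.Ico 0 1))

/-- Reachability probability `Prob(·, ◇G)`. -/
noncomputable def reachProb {σ : Type} [Fintype σ] [Nonempty σ]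
    (P : σ → PMF σ) (init : σ) (G : Set σ) : ℝ≥0∞ :=
  trajMeasure P init {ω | ∃ n, ω n ∈ G}

/-- Expected reward accumulated before reaching `G`. -/
noncomputable def expReward {σ : Type} [Fintype σ] [Nonempty σ]
    (P : σ → PMF σ) (init : σ) (G : Set σ) (rew : σ → ℝ≥0) : ℝ≥0∞ :=
  ∫⁻ ω, (∑' n : ℕ, if ∀ m ≤ n, ω m ∉ G then (rew (ω n) : ℝ≥0∞) else 0)
    ∂(trajMeasure P init)

/-- The (sub)type of realisations of the family `𝔇`. -/
abbrev Realz (𝔇 : MCFamily S K) := {r : K → S // ∀ k, r k ∈ 𝔇.T k}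

/-- Transition function of the Markov chain induced on the all-in-one MDP `M^𝔇`
(state space `Option (S × R^𝔇)`, fresh initial state `none`) by the memoryless
deterministic scheduler that selects action `a_r` at `none` (elsewhere only one action
is enabled): from `none` move surely to `some (s₀, r)`; from `some (s, r')` move to
`some (s', r')` with probability `𝔓(r')(s)(s')`. -/
noncomputable def allInOneTrans [DecidableEq S] [DecidableEq K] (𝔇 : MCFamily S K)
    (r : Realz 𝔇) : Option (S × Realz 𝔇) → PMF (Option (S × Realz 𝔇))
  | none => PMF.pure (some (𝔇.s0, r))
  | some (s, r') => ((𝔇.P s).map r'.val).map fun s' => some (s', r')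

/-- The lifted goal set `{some (s, r') | s ∈ G, r' ∈ R^𝔇}` in the all-in-one MDP. -/
def liftedGoal [DecidableEq S] [DecidableEq K] (𝔇 : MCFamily S K) (G : Set S) :
    Set (Option (S × Realz 𝔇)) :=
  {x | ∃ s ∈ G, ∃ r' : Realz 𝔇, x = some (s, r')}

open ProbabilityTheory

/-- The uniform distribution on `[0, 1)`. -/
noncomputable abbrev unifMeasure : Measure ℝ := (volume : Measure ℝ).restrict (Set.Ico 0 1)

instance : IsProbabilityMeasure unifMeasure := ⟨by simp⟩

/-- The law of a fair coin flip. -/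
noncomputable abbrev fairCoin : Measure (Fin 2) := (PMF.uniformOfFintype (Fin 2)).toMeasure

lemma fairCoin_singleton (a : Fin 2) : fairCoin {a} = 2⁻¹ := by
  rw [PMF.toMeasure_apply_singleton _ _ (measurableSet_singleton a)]
  simp

lemma bit_eq_digits (k : ℕ) (u : ℝ) : bit k u = (Real.digits u 2 k : ℕ) := by
  simp [bit, Real.digits, Int.floor_toNat]

lemma uSlice_eq_ofDigits (i : ℕ) (u : ℝ) :
    uSlice i u = Real.ofDigits fun k => Real.digits u 2 (Nat.pair i k) := by
  simp [uSlice, Real.ofDigits, Real.ofDigitsTerm, bit_eq_digits, div_eq_mul_inv]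

lemma measurable_digits (k : ℕ) : Measurable fun u : ℝ => Real.digits u 2 k := by
  have h : Measurable fun u : ℝ => ⌊u * ((2 : ℕ) : ℝ) ^ (k + 1)⌋₊ :=
    Nat.measurable_floor.comp (by fun_prop)
  exact (measurable_from_top (f := fun m : ℕ => Fin.ofNat 2 m)).comp h

/-- The natural number whose binary expansion is `a 0, …, a (n - 1)`. -/
def prefixVal (a : ℕ → Fin 2) : ℕ → ℕ
  | 0 => 0
  | n + 1 => 2 * prefixVal a n + a n

lemma prefixVal_lt (a : ℕ → Fin 2) (n : ℕ) : prefixVal a n < 2 ^ n := by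
  induction n with
  | zero => simp [prefixVal]
  | succ n ih => have := (a n).isLt; simp only [prefixVal, pow_succ]; omega

lemma digits_eq_iff_floor (a : ℕ → Fin 2) {u : ℝ} (hu : u ∈ Set.Ico (0 : ℝ) 1) (n : ℕ) :
    (∀ k < n, Real.digits u 2 k = a k) ↔ ⌊u * 2 ^ n⌋₊ = prefixVal a n := by
  induction n with
  | zero => simp [prefixVal, Nat.floor_eq_zero.2 hu.2]
  | succ n ih =>
    have h1 : ⌊u * 2 ^ n⌋₊ = ⌊u * 2 ^ (n + 1)⌋₊ / 2 := by
      have := Nat.floor_div_natCast (u * 2 ^ (n + 1)) 2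
      rw [← this]
      congr 1
      push_cast
      ring
    have h2 : (Real.digits u 2 n : ℕ) = ⌊u * 2 ^ (n + 1)⌋₊ % 2 := by
      simp [Real.digits]
    have h3 := (a n).isLt
    rw [Nat.forall_lt_succ_right, ih, h1, Fin.ext_iff, h2, prefixVal]
    omega

lemma unifMeasure_digits_cylinder (a : ℕ → Fin 2) (n : ℕ) :
    unifMeasure {u | ∀ k < n, Real.digits u 2 k = a k} = 2⁻¹ ^ n := by
  have hm : MeasurableSet {u : ℝ | ∀ k < n, Real.digits u 2 k = a k} := by
    simp only [Set.ofPred_forall]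
    exact .iInter fun k => .iInter fun _ => measurable_digits k (measurableSet_singleton _)
  have h2 : (0 : ℝ) < 2 ^ n := by positivity
  have hlt : (prefixVal a n : ℝ) + 1 ≤ 2 ^ n := by exact_mod_cast prefixVal_lt a n
  have key : {u : ℝ | ∀ k < n, Real.digits u 2 k = a k} ∩ Set.Ico 0 1 =
      Set.Ico ((prefixVal a n : ℝ) / 2 ^ n) ((prefixVal a n + 1) / 2 ^ n) := by
    ext u
    simp only [Set.mem_inter_iff, Set.mem_ofPred_eq]
    constructor
    · rintro ⟨h, hu⟩
      rw [digits_eq_iff_floor a hu, Nat.floor_eq_iff (mul_nonneg hu.1 h2.le)] at h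
      exact ⟨(div_le_iff₀ h2).2 h.1, (lt_div_iff₀ h2).2 h.2⟩
    · rintro ⟨h, h'⟩
      have hu : u ∈ Set.Ico (0 : ℝ) 1 :=
        ⟨le_trans (by positivity) h, h'.trans_le ((div_le_one h2).2 hlt)⟩
      refine ⟨?_, hu⟩
      rw [digits_eq_iff_floor a hu, Nat.floor_eq_iff (mul_nonneg hu.1 h2.le)]
      exact ⟨(div_le_iff₀ h2).1 h, (lt_div_iff₀ h2).1 h'⟩
  rw [Measure.restrict_apply hm, key, Real.volume_Ico, ← sub_div, add_sub_cancel_left, one_div,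
    ENNReal.ofReal_inv_of_pos h2, ENNReal.ofReal_pow (by norm_num), ENNReal.inv_pow]
  simp

lemma map_digits_fin (n : ℕ) :
    unifMeasure.map (fun u (k : Fin n) => Real.digits u 2 k) = Measure.pi fun _ => fairCoin := by
  have hm : Measurable fun (u : ℝ) (k : Fin n) => Real.digits u 2 k :=
    measurable_pi_lambda _ fun k => measurable_digits k
  refine Measure.ext_of_singleton fun a => ?_
  rw [Measure.map_apply hm (measurableSet_singleton a), Measure.pi_singleton]
  simp only [fairCoin_singleton, Finset.prod_const, Finset.card_univ, Fintype.card_fin]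
  rw [← unifMeasure_digits_cylinder (fun k => if h : k < n then a ⟨k, h⟩ else 0)]
  congr 1
  ext u
  simp only [Set.mem_preimage, Set.mem_singleton_iff, funext_iff, Set.mem_ofPred_eq, Fin.forall_iff]
  exact forall₂_congr fun k hk => by simp [hk]

lemma map_digits :
    unifMeasure.map (fun u => Real.digits u 2) = Measure.infinitePi fun _ => fairCoin := by
  refine Measure.eq_infinitePi _ fun s t ht => ?_
  obtain ⟨n, hn⟩ : ∃ n, ∀ k ∈ s, k < n := ⟨s.sup id + 1, fun k hk =>
    Nat.lt_succ_of_le (Finset.le_sup (f := id) hk)⟩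
  let t' : ℕ → Set (Fin 2) := fun k => if k ∈ s then t k else Set.univ
  have ht' (k : ℕ) : MeasurableSet (t' k) := MeasurableSet.of_discrete
  have hm : Measurable fun u : ℝ => Real.digits u 2 :=
    measurable_pi_lambda _ fun k => measurable_digits k
  have hm' : Measurable fun (u : ℝ) (k : Fin n) => Real.digits u 2 k :=
    measurable_pi_lambda _ fun k => measurable_digits k
  have h := congrArg (fun ν => ν (Set.univ.pi fun k : Fin n => t' k)) (map_digits_fin n)
  simp only [Measure.pi_pi, Measure.map_apply hm' (.univ_pi fun k : Fin n => ht' k)] at h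
  rw [Measure.map_apply hm (.pi s.countable_toSet fun k _ => ht k)]
  convert! h using 1
  · congr 1
    ext u
    simp only [Set.mem_preimage, Set.mem_pi, Set.mem_univ, true_imp_iff, Finset.mem_coe, t',
      Fin.forall_iff]
    exact ⟨fun h k hk => by split_ifs with hks <;> simp [*],
      fun h k hk => by simpa [hk] using h k (hn k hk)⟩
  · rw [Fin.prod_univ_eq_prod_range (fun k => fairCoin (t' k)) n]
    symm
    rw [← Finset.prod_subset (s₁ := s) (fun k hk => Finset.mem_range.2 (hn k hk))
      fun k _ hk => by simp [t', hk]]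
    exact Finset.prod_congr rfl fun k hk => by simp [t', hk]

lemma infinitePi_fairCoin_map_ofDigits :
    (Measure.infinitePi fun _ : ℕ => fairCoin).map Real.ofDigits = unifMeasure := by
  have hm : Measurable fun u : ℝ => Real.digits u 2 :=
    measurable_pi_lambda _ fun k => measurable_digits k
  rw [← map_digits, Measure.map_map Real.continuous_ofDigits.measurable hm]
  have h : Real.ofDigits ∘ (fun u : ℝ => Real.digits u 2) =ᵐ[unifMeasure] id := by
    filter_upwards [ae_restrict_mem measurableSet_Ico] with u hu
    exact Real.ofDigits_digits one_lt_two hu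
  rw [Measure.map_congr h, Measure.map_id]

lemma measurable_uSlice (i : ℕ) : Measurable (uSlice i) := by
  have h : uSlice i = Real.ofDigits ∘ fun u k => Real.digits u 2 (Nat.pair i k) :=
    funext (uSlice_eq_ofDigits i)
  rw [h]
  exact Real.continuous_ofDigits.measurable.comp
    (measurable_pi_lambda _ fun k => measurable_digits _)

lemma map_uSlice :
    unifMeasure.map (fun u i => uSlice i u) = Measure.infinitePi fun _ : ℕ => unifMeasure := by
  have hm : Measurable fun u : ℝ => Real.digits u 2 :=
    measurable_pi_lambda _ fun k => measurable_digits k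
  have hpair : Function.Injective fun p : ℕ × ℕ => Nat.pair p.1 p.2 := Nat.pairEquiv.injective
  have hof : Measurable (Real.ofDigits : (ℕ → Fin 2) → ℝ) := Real.continuous_ofDigits.measurable
  have h1 := Measure.map_infinitePi_infinitePi_of_inj (P := fun _ : ℕ => fairCoin) hpair
  have h2 := Measure.infinitePi_map_curry (ι := ℕ) (κ := ℕ) fun _ _ => fairCoin
  have h3 := Measure.infinitePi_map_pi (μ := fun _ : ℕ => Measure.infinitePi fun _ : ℕ => fairCoin)
    (f := fun _ => Real.ofDigits) fun _ => hof
  simp only [infinitePi_fairCoin_map_ofDigits] at h3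
  rw [← h3, ← h2, ← h1, ← map_digits, Measure.map_map _ hm, Measure.map_map, Measure.map_map]
  · simp only [uSlice_eq_ofDigits]
    rfl
  all_goals fun_prop

lemma map_uSlice_eval (i : ℕ) : unifMeasure.map (uSlice i) = unifMeasure := by
  have h := congrArg (Measure.map fun w : ℕ → ℝ => w i) map_uSlice
  rw [Measure.map_map (by fun_prop) (measurable_pi_lambda _ measurable_uSlice),
    Measure.infinitePi_map_eval] at h
  exact h

lemma iIndepFun_uSlice : iIndepFun uSlice unifMeasure := by
  rw [iIndepFun_iff_map_fun_eq_infinitePi_map measurable_uSlice]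
  simp only [map_uSlice_eval, map_uSlice]

section Sampling

variable {σ : Type} [Fintype σ]

lemma cumul_succ (P : PMF σ) (j : Fin (Fintype.card σ)) :
    cumul P (j + 1) = cumul P j + (P ((Fintype.equivFin σ).symm j)).toReal := by
  have h : (Finset.univ.filter fun i : Fin (Fintype.card σ) => (i : ℕ) < j + 1) =
      insert j (Finset.univ.filter fun i : Fin (Fintype.card σ) => (i : ℕ) < j) := by
    ext i
    simp only [Finset.mem_filter, Finset.mem_univ, true_and, Finset.mem_insert, Fin.ext_iff]
    omega
  rw [cumul, h, Finset.sum_insert (by simp), add_comm, cumul]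

lemma cumul_mono (P : PMF σ) : Monotone (cumul P) := fun a b hab =>
  Finset.sum_le_sum_of_subset_of_nonneg
    (fun i => by simp only [Finset.mem_filter, Finset.mem_univ, true_and]; omega)
    fun _ _ _ => ENNReal.toReal_nonneg

lemma cumul_zero (P : PMF σ) : cumul P 0 = 0 := by simp [cumul]

lemma cumul_card (P : PMF σ) : cumul P (Fintype.card σ) = 1 := by
  have h := P.tsum_coe
  rw [tsum_fintype, ← (Fintype.equivFin σ).symm.sum_comp] at h
  simp only [cumul, Fin.is_lt, Finset.filter_true]
  rw [← ENNReal.toReal_sum fun _ _ => P.apply_ne_top _, h, ENNReal.toReal_one]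

lemma sample_eq_iff [Nonempty σ] (P : PMF σ) {u : ℝ} (hu : u ∈ Set.Ico (0 : ℝ) 1)
    (j : Fin (Fintype.card σ)) :
    sample P u = (Fintype.equivFin σ).symm j ↔ u ∈ Set.Ico (cumul P j) (cumul P (j + 1)) := by
  have hcard : 0 < Fintype.card σ := Fintype.card_pos
  have hne : (Finset.univ.filter fun j : Fin (Fintype.card σ) =>
      u < cumul P ((j : ℕ) + 1)).Nonempty := by
    refine ⟨⟨Fintype.card σ - 1, by omega⟩, ?_⟩
    simp [Nat.sub_add_cancel hcard, cumul_card, hu.2]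
  rw [sample, dif_pos hne, Equiv.apply_eq_iff_eq, Finset.min'_eq_iff]
  simp only [Finset.mem_filter, Finset.mem_univ, true_and, Set.mem_Ico]
  refine ⟨fun ⟨h, hmin⟩ => ⟨?_, h⟩, fun ⟨h, h'⟩ => ⟨h', fun i hi => ?_⟩⟩
  · by_contra! hlt
    obtain ⟨j, hj⟩ := j
    cases j with
    | zero => simp only [cumul_zero] at hlt; exact absurd hu.1 hlt.not_ge
    | succ j =>
      have := hmin ⟨j, by omega⟩ hlt
      simp [Fin.le_def] at this
  · by_contra! hij
    exact absurd (hi.trans_le ((cumul_mono P (Nat.succ_le_of_lt hij)).trans h)) (lt_irrefl _)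

lemma measurable_sample [Nonempty σ] [MeasurableSpace σ] (P : PMF σ) :
    Measurable (sample P) := by
  let _ : MeasurableSpace (Finset (Fin (Fintype.card σ))) := ⊤
  have hF : Measurable fun u : ℝ => Finset.univ.filter fun j : Fin (Fintype.card σ) =>
      u < cumul P ((j : ℕ) + 1) := by
    refine measurable_to_countable' fun s => ?_
    have h : (fun u : ℝ => Finset.univ.filter fun j : Fin (Fintype.card σ) =>
        u < cumul P ((j : ℕ) + 1)) ⁻¹' {s} =
        ⋂ j : Fin (Fintype.card σ), {u : ℝ | u < cumul P ((j : ℕ) + 1) ↔ j ∈ s} := by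
      ext u; simp [Finset.ext_iff]
    rw [h]
    exact .iInter fun j => (measurableSet_Iio.mem.iff measurable_const).setOf
  exact (measurable_from_top (f := fun s : Finset (Fin (Fintype.card σ)) =>
    (Fintype.equivFin σ).symm (if h : s.Nonempty then s.min' h else ⟨0, Fintype.card_pos⟩))).comp hF

lemma unifMeasure_sample_preimage [Nonempty σ] (P : PMF σ) (y : σ) :
    unifMeasure (sample P ⁻¹' {y}) = P y := by
  let _ : MeasurableSpace σ := ⊤
  obtain ⟨j, rfl⟩ := (Fintype.equivFin σ).symm.surjective y
  have hle : cumul P (j + 1) ≤ 1 := (cumul_mono P j.isLt).trans_eq (cumul_card P)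
  have h0 : 0 ≤ cumul P j := (cumul_zero P).symm.le.trans (cumul_mono P (Nat.zero_le _))
  have key : sample P ⁻¹' {(Fintype.equivFin σ).symm j} ∩ Set.Ico 0 1 =
      Set.Ico (cumul P j) (cumul P (j + 1)) := by
    ext u
    simp only [Set.mem_inter_iff, Set.mem_preimage, Set.mem_singleton_iff]
    constructor
    · rintro ⟨h, hu⟩
      exact (sample_eq_iff P hu j).1 h
    · intro h
      have hu : u ∈ Set.Ico (0 : ℝ) 1 := ⟨h0.trans h.1, h.2.trans_le hle⟩
      exact ⟨(sample_eq_iff P hu j).2 h, hu⟩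
  rw [Measure.restrict_apply (measurable_sample P (MeasurableSet.of_discrete)), key,
    Real.volume_Ico, cumul_succ, add_sub_cancel_left, ENNReal.ofReal_toReal (P.apply_ne_top _)]

end Sampling

section Avoidance

variable {σ : Type} [Fintype σ] [Nonempty σ]

/-- The `σ`-algebra on the sample space generated by the first `n` uniform variables. -/
noncomputable abbrev uSlicePast (n : ℕ) : MeasurableSpace ℝ :=
  ⨆ i ∈ Set.Iio n, MeasurableSpace.comap (uSlice i) inferInstance

lemma uSlicePast_le (n : ℕ) : uSlicePast n ≤ borel ℝ := by
  rw [← BorelSpace.measurable_eq (α := ℝ)]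
  exact iSup₂_le fun i _ => (measurable_uSlice i).comap_le

lemma uSlicePast_mono : Monotone uSlicePast := fun _ _ h =>
  biSup_mono fun _ hi => lt_of_lt_of_le hi h

lemma measurable_simTraj_past (P : σ → PMF σ) (init : σ) (n : ℕ) :
    Measurable[uSlicePast n, ⊤] fun u => simTraj P init u n := by
  let _ : MeasurableSpace σ := ⊤
  induction n with
  | zero => exact measurable_const
  | succ n ih =>
    have hU : Measurable[uSlicePast (n + 1)] (uSlice n) :=
      (comap_measurable (uSlice n)).mono
        (le_iSup₂_of_le (f := fun i (_ : i ∈ Set.Iio (n + 1)) =>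
          MeasurableSpace.comap (uSlice i) inferInstance) n (Nat.lt_succ_self n) le_rfl) le_rfl
    have hX : Measurable[uSlicePast (n + 1)] fun u => simTraj P init u n :=
      ih.mono (uSlicePast_mono n.le_succ) le_rfl
    have hs : Measurable fun p : σ × ℝ => sample (P p.1) p.2 :=
      measurable_from_prod_countable_right fun x => measurable_sample (P x)
    have h := hs.comp (hX.prodMk hU)
    simp only [simTraj]
    exact h

lemma measurable_simTraj [MeasurableSpace σ] (P : σ → PMF σ) (init : σ) (n : ℕ) :
    Measurable fun u => simTraj P init u n :=
  (measurable_simTraj_past P init n).mono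
    ((uSlicePast_le n).trans (BorelSpace.measurable_eq (α := ℝ)).symm.le) le_top

/-- The event that the simulated chain avoids `G` up to time `n`. -/
def avoidEvent (P : σ → PMF σ) (init : σ) (G : Set σ) (n : ℕ) : Set ℝ :=
  {u | ∀ m ≤ n, simTraj P init u m ∉ G}

lemma measurableSet_avoidEvent_past (P : σ → PMF σ) (init : σ) (G : Set σ) (n : ℕ) :
    MeasurableSet[uSlicePast n] (avoidEvent P init G n) := by
  simp only [avoidEvent, Set.ofPred_forall]
  refine MeasurableSet.iInter fun m => MeasurableSet.iInter fun hm => ?_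
  exact uSlicePast_mono hm _ (measurable_simTraj_past P init m (t := Gᶜ) trivial)

lemma measurableSet_avoidEvent (P : σ → PMF σ) (init : σ) (G : Set σ) (n : ℕ) :
    MeasurableSet (avoidEvent P init G n) :=
  ((uSlicePast_le n).trans (BorelSpace.measurable_eq (α := ℝ)).symm.le) _
    (measurableSet_avoidEvent_past P init G n)

/-- The probability that the chain avoids `G` up to time `n` and is then in state `x`. -/
noncomputable def avoidProb (P : σ → PMF σ) (init : σ) (G : Set σ) : ℕ → σ → ℝ≥0∞
  | 0, x => if x ∈ G then 0 else if x = init then 1 else 0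
  | n + 1, y => if y ∈ G then 0 else ∑ x, avoidProb P init G n x * P x y

lemma unifMeasure_avoidEvent_inter (P : σ → PMF σ) (init : σ) (G : Set σ) (n : ℕ) (x : σ) :
    unifMeasure (avoidEvent P init G n ∩ {u | simTraj P init u n = x}) =
      avoidProb P init G n x := by
  let _ : MeasurableSpace σ := ⊤
  induction n generalizing x with
  | zero =>
    by_cases hx : x ∈ G
    · have h : avoidEvent P init G 0 ∩ {u | simTraj P init u 0 = x} = ∅ := by
        ext u
        simp only [avoidEvent, Set.mem_inter_iff, Set.mem_ofPred_eq, Set.mem_empty_iff_false,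
          iff_false, not_and]
        rintro h rfl
        exact h 0 le_rfl hx
      simp [h, avoidProb, hx]
    · by_cases hxi : x = init
      · subst hxi
        have h : avoidEvent P x G 0 ∩ {u | simTraj P x u 0 = x} = Set.univ := by
          ext u
          simp [avoidEvent, simTraj, hx]
        rw [h, measure_univ]
        simp [avoidProb, hx]
      · simp [avoidProb, hx, hxi, simTraj, Ne.symm hxi]
  | succ n ih =>
    by_cases hx : x ∈ G
    · have h : avoidEvent P init G (n + 1) ∩ {u | simTraj P init u (n + 1) = x} = ∅ := by
        ext u
        simp only [avoidEvent, Set.mem_inter_iff, Set.mem_ofPred_eq, Set.mem_empty_iff_false,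
          iff_false, not_and]
        rintro h rfl
        exact h (n + 1) le_rfl hx
      simp [h, avoidProb, hx]
    · let A : σ → Set ℝ := fun z => avoidEvent P init G n ∩ {u | simTraj P init u n = z}
      let B : σ → Set ℝ := fun z => uSlice n ⁻¹' (sample (P z) ⁻¹' {x})
      have hAp (z : σ) : MeasurableSet[uSlicePast n] (A z) :=
        (measurableSet_avoidEvent_past P init G n).inter
          (measurable_simTraj_past P init n (t := {z}) trivial)
      have hA (z : σ) : MeasurableSet (A z) :=
        ((uSlicePast_le n).trans (BorelSpace.measurable_eq (α := ℝ)).symm.le) _ (hAp z)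
      have hS (z : σ) : MeasurableSet (sample (P z) ⁻¹' {x}) :=
        measurable_sample (P z) (MeasurableSet.of_discrete)
      have hB (z : σ) : MeasurableSet (B z) := measurable_uSlice n (hS z)
      have hunion : avoidEvent P init G (n + 1) ∩ {u | simTraj P init u (n + 1) = x} =
          ⋃ z ∈ (Finset.univ : Finset σ), A z ∩ B z := by
        ext u
        simp only [avoidEvent, Set.mem_inter_iff, Set.mem_ofPred_eq, Set.mem_iUnion,
          Finset.mem_univ, exists_const, A, B, Set.mem_preimage, Set.mem_singleton_iff]
        constructor
        · rintro ⟨h, h'⟩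
          exact ⟨_, ⟨fun m hm => h m (hm.trans n.le_succ), rfl⟩, h'⟩
        · rintro ⟨z, ⟨h, rfl⟩, h'⟩
          refine ⟨fun m hm => ?_, h'⟩
          rcases Nat.le_succ_iff.1 hm with hm | rfl
          · exact h m hm
          · exact fun hG => hx (h' ▸ hG)
      have hind : Indep (uSlicePast n) (⨆ i ∈ ({n} : Set ℕ),
          MeasurableSpace.comap (uSlice i) inferInstance) unifMeasure :=
        indep_iSup_of_disjoint (fun i => (measurable_uSlice i).comap_le)
          iIndepFun_uSlice.iIndep (by simp)
      have hBn (z : σ) : MeasurableSet[⨆ i ∈ ({n} : Set ℕ),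
          MeasurableSpace.comap (uSlice i) inferInstance] (B z) := by
        rw [iSup_singleton]
        exact ⟨_, hS z, rfl⟩
      have hprod (z : σ) : unifMeasure (A z ∩ B z) = avoidProb P init G n z * P z x := by
        rw [(Indep_iff _ _ _).1 hind _ _ (hAp z) (hBn z), ih,
          ← unifMeasure_sample_preimage (P z) x]
        conv_rhs => rw [← map_uSlice_eval n, Measure.map_apply (measurable_uSlice n) (hS z)]
      rw [hunion, measure_biUnion_finset _ fun z _ => (hA z).inter (hB z)]
      · simp [hprod, avoidProb, hx]
      · intro z _ z' _ hzz'
        refine Set.disjoint_left.2 fun u hu hu' => hzz' ?_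
        exact hu.1.2.symm.trans hu'.1.2

lemma unifMeasure_avoidEvent (P : σ → PMF σ) (init : σ) (G : Set σ) (n : ℕ) :
    unifMeasure (avoidEvent P init G n) = ∑ x, avoidProb P init G n x := by
  let _ : MeasurableSpace σ := ⊤
  simp only [← unifMeasure_avoidEvent_inter]
  have hX (x : σ) : MeasurableSet {u | simTraj P init u n = x} :=
    measurable_simTraj P init n (MeasurableSet.of_discrete (s := {x}))
  rw [← measure_biUnion_finset _ fun x _ => (measurableSet_avoidEvent P init G n).inter (hX x)]
  · congr 1
    ext u
    simp
  · intro z _ z' _ hzz'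
    exact Set.disjoint_left.2 fun u hu hu' => hzz' (hu.2.symm.trans hu'.2)

lemma avoidEvent_antitone (P : σ → PMF σ) (init : σ) (G : Set σ) :
    Antitone (avoidEvent P init G) := fun _ _ hab _ hu m hm => hu m (hm.trans hab)

lemma sum_avoidProb_antitone (P : σ → PMF σ) (init : σ) (G : Set σ) :
    Antitone fun n => ∑ x, avoidProb P init G n x := fun _ _ hab => by
  simp only [← unifMeasure_avoidEvent]
  exact measure_mono (avoidEvent_antitone P init G hab)

theorem reachProb_eq (P : σ → PMF σ) (init : σ) (G : Set σ) :
    reachProb P init G = 1 - ⨅ n, ∑ x, avoidProb P init G n x := by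
  let _ : MeasurableSpace σ := ⊤
  have hG : MeasurableSet {ω : ℕ → σ | ∃ n, ω n ∈ G} := by
    simp only [Set.ofPred_exists]
    exact .iUnion fun n => measurable_pi_apply n (MeasurableSet.of_discrete (s := G))
  have hset : simTraj P init ⁻¹' {ω | ∃ n, ω n ∈ G} = (⋂ n, avoidEvent P init G n)ᶜ := by
    ext u
    simp only [Set.mem_preimage, Set.mem_ofPred_eq, Set.mem_compl_iff, Set.mem_iInter, avoidEvent,
      not_forall, not_not]
    exact ⟨fun ⟨n, h⟩ => ⟨n, n, le_rfl, h⟩, fun ⟨_, m, _, h⟩ => ⟨m, h⟩⟩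
  have hA := measurableSet_avoidEvent P init G
  rw [reachProb, trajMeasure,
    Measure.map_apply (measurable_pi_lambda _ (measurable_simTraj P init)) hG, hset,
    prob_compl_eq_one_sub (.iInter hA),
    (avoidEvent_antitone P init G).measure_iInter (fun n => (hA n).nullMeasurableSet)
      ⟨0, measure_ne_top _ _⟩]
  simp only [unifMeasure_avoidEvent]

end Avoidance

lemma PMF.map_apply_of_injective {α β : Type*} {f : α → β} (hf : f.Injective) (p : PMF α)
    (a : α) : p.map f (f a) = p a := by
  rw [PMF.map_apply, tsum_eq_single a fun b hb => if_neg fun h => hb (hf h).symm, if_pos rfl]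

section AllInOne

variable [DecidableEq S] [DecidableEq K] (𝔇 : MCFamily S K) (G : Set S) (r : Realz 𝔇)

lemma allInOneTrans_some_some (s s' : S) :
    allInOneTrans 𝔇 r (some (s, r)) (some (s', r)) = familyTrans 𝔇 r.val s s' :=
  PMF.map_apply_of_injective (f := fun s' => some (s', r)) (fun _ _ h => by simpa using h) _ s'

lemma some_mem_liftedGoal (s : S) (r' : Realz 𝔇) :
    (some (s, r') : Option (S × Realz 𝔇)) ∈ liftedGoal 𝔇 G ↔ s ∈ G := by
  simp only [liftedGoal, Set.mem_ofPred_eq, Option.some.injEq, Prod.mk.injEq]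
  exact ⟨fun ⟨_, h, _, h', _⟩ => h' ▸ h, fun h => ⟨s, h, r', rfl, rfl⟩⟩

lemma none_notMem_liftedGoal : none ∉ liftedGoal 𝔇 G := by
  simp [liftedGoal]

lemma avoidProb_allInOne_none (n : ℕ) :
    avoidProb (allInOneTrans 𝔇 r) none (liftedGoal 𝔇 G) (n + 1) none = 0 := by
  rw [avoidProb, if_neg (none_notMem_liftedGoal 𝔇 G)]
  refine Finset.sum_eq_zero fun x _ => ?_
  rcases x with _ | ⟨s, r'⟩ <;> simp [allInOneTrans, PMF.map_apply]

lemma avoidProb_allInOne_some (n : ℕ) (s : S) (r' : Realz 𝔇) :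
    avoidProb (allInOneTrans 𝔇 r) none (liftedGoal 𝔇 G) (n + 1) (some (s, r')) =
      if r' = r then avoidProb (familyTrans 𝔇 r.val) 𝔇.s0 G n s else 0 := by
  induction n generalizing s r' with
  | zero =>
    simp only [avoidProb, some_mem_liftedGoal, none_notMem_liftedGoal, Fintype.sum_option,
      allInOneTrans, PMF.pure_apply]
    by_cases hs : s ∈ G <;> by_cases hr : r' = r <;> simp [hs, hr]
  | succ n ih =>
    rw [avoidProb, some_mem_liftedGoal, Fintype.sum_option, avoidProb_allInOne_none, zero_mul,
      zero_add, Fintype.sum_prod_type]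
    simp only [ih, ite_mul, zero_mul, Finset.sum_ite_eq', Finset.mem_univ, if_true]
    by_cases hr : r' = r
    · subst hr
      simp only [allInOneTrans_some_some, if_true, avoidProb]
    · have h (x : S) : allInOneTrans 𝔇 r (some (x, r)) (some (s, r')) = 0 := by
        simp [allInOneTrans, PMF.map_apply, hr]
      simp [h, hr]

lemma sum_avoidProb_allInOne (n : ℕ) :
    ∑ x, avoidProb (allInOneTrans 𝔇 r) none (liftedGoal 𝔇 G) (n + 1) x =
      ∑ s, avoidProb (familyTrans 𝔇 r.val) 𝔇.s0 G n s := by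
  rw [Fintype.sum_option, avoidProb_allInOne_none, zero_add, Fintype.sum_prod_type]
  simp only [avoidProb_allInOne_some, Finset.sum_ite_eq', Finset.mem_univ, if_true]

theorem reachProb_allInOne [Nonempty S] :
    reachProb (allInOneTrans 𝔇 r) none (liftedGoal 𝔇 G) =
      reachProb (familyTrans 𝔇 r.val) 𝔇.s0 G := by
  rw [reachProb_eq, reachProb_eq,
    ← (sum_avoidProb_antitone (allInOneTrans 𝔇 r) none (liftedGoal 𝔇 G)).iInf_nat_add 1]
  simp only [sum_avoidProb_allInOne]

end AllInOne

/-- A memoryless deterministic scheduler of the all-in-one MDP reaching the lifted goal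
set with probability at most `λ` exists iff a consistent memoryless deterministic
scheduler of the quotient MDP with `Prob(◇G) ≤ λ` exists. -/
theorem allInOne_iff_consistent_quotient [DecidableEq S] [DecidableEq K] [Nonempty S]
    (𝔇 : MCFamily S K) (G : Set S) (lam : ℝ≥0∞) (hlam : lam ≤ 1) :
    (∃ r : Realz 𝔇, reachProb (allInOneTrans 𝔇 r) none (liftedGoal 𝔇 G) ≤ lam) ↔
    (∃ σ : S → (K → S), (∀ s, σ s ∈ Realisations 𝔇) ∧ (∀ s s' k, σ s k = σ s' k) ∧
      reachProb (fun s => (𝔇.P s).map (σ s)) 𝔇.s0 G ≤ lam) := by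
  constructor
  · rintro ⟨r, hr⟩
    exact ⟨fun _ => r.val, fun _ => r.property, fun _ _ _ => rfl,
      (reachProb_allInOne 𝔇 G r).symm.trans_le hr⟩
  · rintro ⟨σ, hσ, hcons, hle⟩
    refine ⟨⟨σ 𝔇.s0, hσ 𝔇.s0⟩, ?_⟩
    have h : (fun s => (𝔇.P s).map (σ s)) = familyTrans 𝔇 (σ 𝔇.s0) := by
      ext1 s
      rw [familyTrans, funext (hcons s 𝔇.s0)]
    rw [reachProb_allInOne, ← h]
    exact hle
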